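/- arXiv:1909.04652 — 3 statements merged into one kernel-verified Lean document; each statement's English description precedes it below -/
import Mathlib

section
/- Let k > 0 and let x : ℝ → ℝ² be twice differentiable with x(t) ≠ 0 for all t and satisfying x''(t) = −k·x(t)/‖x(t)‖³ for all t ∈ ℝ, and let l(t) := x₁(t)·x₂'(t) − x₂(t)·x₁'(t) be the angular momentum. Then the Runge–Lenz vector A(t) := ( x₂'(t)·l(t) − k·x₁(t)/‖x(t)‖ , −x₁'(t)·l(t) − k·x₂(t)/‖x(t)‖ ) ∈ ℝ² is constant in t. (In particular, the direction of the semi-major axis of a Kepler orbit does not move: the exact Newtonian problem has zero perihelion advance.) -/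
/-- For the planar Kepler problem `x'' = -k x / ‖x‖³`, the Runge–Lenz vector
`A = (v₂ l - k x₁/‖x‖, -v₁ l - k x₂/‖x‖)`, where `l = x₁ v₂ - x₂ v₁` is the
angular momentum, is constant in time: the exact Newtonian problem has zero
perihelion advance. -/
theorem kepler_runge_lenz_constant
    (k : ℝ) (hk : 0 < k)
    (x : ℝ → EuclideanSpace ℝ (Fin 2))
    (hx₁ : Differentiable ℝ x) (hx₂ : Differentiable ℝ (deriv x))
    (hne : ∀ t : ℝ, x t ≠ 0)
    (heq : ∀ t : ℝ, deriv (deriv x) t = (-(k / ‖x t‖ ^ 3)) • x t) :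
    ∀ t s : ℝ,
      (deriv x t 1 * (x t 0 * deriv x t 1 - x t 1 * deriv x t 0) - k * x t 0 / ‖x t‖ =
       deriv x s 1 * (x s 0 * deriv x s 1 - x s 1 * deriv x s 0) - k * x s 0 / ‖x s‖) ∧
      (-(deriv x t 0) * (x t 0 * deriv x t 1 - x t 1 * deriv x t 0) - k * x t 1 / ‖x t‖ =
       -(deriv x s 0) * (x s 0 * deriv x s 1 - x s 1 * deriv x s 0) - k * x s 1 / ‖x s‖) := by
  have ha : ∀ (i : Fin 2) (t : ℝ), HasDerivAt (fun t => x t i) (deriv x t i) t := fun i t =>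
    (EuclideanSpace.proj (𝕜 := ℝ) i).hasFDerivAt.comp_hasDerivAt t (hx₁ t).hasDerivAt
  have hv : ∀ (i : Fin 2) (t : ℝ),
      HasDerivAt (fun t => deriv x t i) (-(k / ‖x t‖ ^ 3) * x t i) t := fun i t => by
    have h := (EuclideanSpace.proj (𝕜 := ℝ) i).hasFDerivAt.comp_hasDerivAt t (hx₂ t).hasDerivAt
    rw [heq t] at h
    exact h
  have hr2 : ∀ t, ‖x t‖ ^ 2 = x t 0 ^ 2 + x t 1 ^ 2 := fun t => by
    rw [EuclideanSpace.norm_sq_eq]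
    simp
  have hr0 : ∀ t, ‖x t‖ ≠ 0 := fun t => norm_ne_zero_iff.mpr (hne t)
  have hr : ∀ t, HasDerivAt (fun t => ‖x t‖)
      ((x t 0 * deriv x t 0 + x t 1 * deriv x t 1) / ‖x t‖) t := fun t => by
    have hs : (fun t => ‖x t‖) = fun t => √(x t 0 ^ 2 + x t 1 ^ 2) := by
      funext t
      rw [← hr2, Real.sqrt_sq (norm_nonneg _)]
    have h := (((ha 0 t).pow 2).add ((ha 1 t).pow 2)).sqrt (by
      have := pow_ne_zero 2 (hr0 t)
      rw [hr2] at this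
      simpa using this)
    rw [hs]
    have e : √(x t 0 ^ 2 + x t 1 ^ 2) = ‖x t‖ := by
      rw [← hr2, Real.sqrt_sq (norm_nonneg _)]
    refine HasDerivAt.congr_deriv (h) ?_
    have := hr0 t
    change _ / (2 * √(x t 0 ^ 2 + x t 1 ^ 2)) = _
    rw [e]
    field_simp
    norm_num
    ring
  have hl : ∀ t, HasDerivAt (fun t => x t 0 * deriv x t 1 - x t 1 * deriv x t 0) 0 t := fun t => by
    refine HasDerivAt.congr_deriv (((ha 0 t).mul (hv 1 t)).sub ((ha 1 t).mul (hv 0 t))) ?_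
    ring
  have h1 : ∀ t, HasDerivAt (fun t => deriv x t 1 * (x t 0 * deriv x t 1 - x t 1 * deriv x t 0)
      - k * x t 0 / ‖x t‖) 0 t := fun t => by
    refine HasDerivAt.congr_deriv (((hv 1 t).mul (hl t)).sub (((ha 0 t).const_mul k).div (hr t) (hr0 t))) ?_
    have := hr0 t
    have h2 := hr2 t
    field_simp
    linear_combination (-k) * deriv x t 0 * h2
  have h2 : ∀ t, HasDerivAt (fun t => -(deriv x t 0) * (x t 0 * deriv x t 1 - x t 1 * deriv x t 0)
      - k * x t 1 / ‖x t‖) 0 t := fun t => by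
    refine HasDerivAt.congr_deriv (((hv 0 t).neg.mul (hl t)).sub (((ha 1 t).const_mul k).div (hr t) (hr0 t))) ?_
    have := hr0 t
    have h2 := hr2 t
    field_simp
    linear_combination (-k) * deriv x t 1 * h2
  intro t s
  exact ⟨is_const_of_deriv_eq_zero (fun t => (h1 t).differentiableAt) (fun t => (h1 t).deriv) t s,
    is_const_of_deriv_eq_zero (fun t => (h2 t).differentiableAt) (fun t => (h2 t).deriv) t s⟩
end

section
/- Let g : ℤ × ℤ → ℝ be an arbitrary function. Define G : ℝ² → ℝ by G(u,v) = g(i+1, j)·(1−ξ) + g(i+1, j+1)·ξ, where i = ⌊u⌋, j = ⌊v⌋, ξ = u − i (the y-component of the linear force-interpolation scheme). Fix u₀ ∈ ℝ with ξ₀ := u₀ − ⌊u₀⌋ and i₀ := ⌊u₀⌋, and fix an integer j₀. Then the one-sided limit of G(u₀, v) as v → j₀ from below exists and equals g(i₀+1, j₀−1)·(1−ξ₀) + g(i₀+1, j₀)·ξ₀, while G(u₀, j₀) = g(i₀+1, j₀)·(1−ξ₀) + g(i₀+1, j₀+1)·ξ₀; hence G has a jump across the horizontal lattice line v = j₀ of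 size (1−ξ₀)·(g(i₀+1, j₀) − g(i₀+1, j₀−1)) + ξ₀·(g(i₀+1, j₀+1) − g(i₀+1, j₀)), and the map v ↦ G(u₀,v) is continuous at v = j₀ if and only if this jump vanishes. -/
/-- The y-component of the linear force-interpolation scheme,
`G(u,v) = g(⌊u⌋+1,⌊v⌋)(1-ξ) + g(⌊u⌋+1,⌊v⌋+1) ξ` with `ξ = u - ⌊u⌋`, has a jump
across each horizontal lattice line `v = j₀`: the left limit at `j₀` is
`g(i₀+1, j₀-1)(1-ξ₀) + g(i₀+1, j₀) ξ₀` while the value is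
`g(i₀+1, j₀)(1-ξ₀) + g(i₀+1, j₀+1) ξ₀`, and `v ↦ G(u₀,v)` is continuous at
`j₀` if and only if the jump
`(1-ξ₀)(g(i₀+1,j₀) - g(i₀+1,j₀-1)) + ξ₀(g(i₀+1,j₀+1) - g(i₀+1,j₀))`
vanishes. -/
theorem linear_interpolation_y_component_jump
    (g : ℤ × ℤ → ℝ) (G : ℝ × ℝ → ℝ)
    (hG : ∀ u v : ℝ,
      G (u, v) = g (⌊u⌋ + 1, ⌊v⌋) * (1 - Int.fract u) + g (⌊u⌋ + 1, ⌊v⌋ + 1) * Int.fract u)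
    (u₀ : ℝ) (j₀ : ℤ) :
    let i₀ : ℤ := ⌊u₀⌋
    let ξ₀ : ℝ := u₀ - (⌊u₀⌋ : ℝ)
    Filter.Tendsto (fun v : ℝ => G (u₀, v)) (nhdsWithin (j₀ : ℝ) (Set.Iio (j₀ : ℝ)))
      (nhds (g (i₀ + 1, j₀ - 1) * (1 - ξ₀) + g (i₀ + 1, j₀) * ξ₀)) ∧
    G (u₀, (j₀ : ℝ)) = g (i₀ + 1, j₀) * (1 - ξ₀) + g (i₀ + 1, j₀ + 1) * ξ₀ ∧
    (ContinuousAt (fun v : ℝ => G (u₀, v)) (j₀ : ℝ) ↔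
      (1 - ξ₀) * (g (i₀ + 1, j₀) - g (i₀ + 1, j₀ - 1)) +
        ξ₀ * (g (i₀ + 1, j₀ + 1) - g (i₀ + 1, j₀)) = 0) := by
  intro i₀ ξ₀
  have hξ : Int.fract u₀ = ξ₀ := rfl
  have hval : G (u₀, (j₀ : ℝ)) = g (i₀ + 1, j₀) * (1 - ξ₀) + g (i₀ + 1, j₀ + 1) * ξ₀ := by
    rw [hG, hξ, Int.floor_intCast]
  have hleft : Filter.Tendsto (fun v : ℝ => G (u₀, v)) (nhdsWithin (j₀ : ℝ) (Set.Iio (j₀ : ℝ)))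
      (nhds (g (i₀ + 1, j₀ - 1) * (1 - ξ₀) + g (i₀ + 1, j₀) * ξ₀)) := by
    apply tendsto_const_nhds.congr'
    filter_upwards [Ioo_mem_nhdsLT (show (j₀ : ℝ) - 1 < j₀ by linarith)] with v hv
    have hf : ⌊v⌋ = j₀ - 1 := by
      rw [Int.floor_eq_iff]
      push_cast
      exact ⟨hv.1.le, by linarith [hv.2]⟩
    rw [hG, hξ, hf, sub_add_cancel]
  have hright : Filter.Tendsto (fun v : ℝ => G (u₀, v)) (nhdsWithin (j₀ : ℝ) (Set.Ici (j₀ : ℝ)))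
      (nhds (G (u₀, (j₀ : ℝ)))) := by
    apply tendsto_const_nhds.congr'
    filter_upwards [Ico_mem_nhdsGE (show (j₀ : ℝ) < j₀ + 1 by linarith)] with v hv
    have hf : ⌊v⌋ = j₀ := by
      rw [Int.floor_eq_iff]
      exact ⟨hv.1, hv.2⟩
    rw [hval, hG, hξ, hf]
  refine ⟨hleft, hval, ?_, ?_⟩
  · intro hc
    have h := tendsto_nhds_unique hleft (hc.tendsto.mono_left nhdsWithin_le_nhds)
    simp only [hval] at h
    linarith
  · intro h
    have he : g (i₀ + 1, j₀ - 1) * (1 - ξ₀) + g (i₀ + 1, j₀) * ξ₀ = G (u₀, (j₀ : ℝ)) := by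
      rw [hval]
      linarith
    rw [he] at hleft
    have h2 := hleft.sup hright
    rwa [nhdsLT_sup_nhdsGE] at h2
end

section
/- Let Φ : ℝ² → ℝ be continuously differentiable. For h > 0 define the centered-difference lattice values f_h(i,j) := (Φ((i+1)h, jh) − Φ((i−1)h, jh))/(2h) for (i,j) ∈ ℤ², and define the bilinear interpolant F_h : ℝ² → ℝ on the lattice of spacing h by F_h(u,v) = (f_h(i,j)·(1−ξ) + f_h(i+1,j)·ξ)·(1−η) + (f_h(i,j+1)·(1−ξ) + f_h(i+1,j+1)·ξ)·η, where i = ⌊u/h⌋, j = ⌊v/h⌋, ξ = u/h − i, η = v/h − j. Then for every point p = (u,v) ∈ ℝ², F_h(p) converges to the partial derivative ∂Φ/∂x (p) as h → 0⁺. -/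
/-- Convergence of the particle-mesh force: for a continuously differentiable
potential `Φ : ℝ² → ℝ`, the bilinear interpolant `F_h` (on a lattice of spacing
`h`) of the centered-difference lattice forces
`f_h(i,j) = (Φ((i+1)h, jh) - Φ((i-1)h, jh))/(2h)` converges, at every point
`p`, to the partial derivative `∂Φ/∂x(p)` as `h → 0⁺`. -/
theorem bilinear_centered_difference_force_converges
    (Φ : ℝ × ℝ → ℝ) (hΦ : ContDiff ℝ 1 Φ)
    (fh : ℝ → ℤ → ℤ → ℝ)
    (hfh : ∀ (h : ℝ) (i j : ℤ),
      fh h i j = (Φ (((i : ℝ) + 1) * h, (j : ℝ) * h) - Φ (((i : ℝ) - 1) * h, (j : ℝ) * h)) / (2 * h))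
    (F : ℝ → ℝ × ℝ → ℝ)
    (hF : ∀ h : ℝ, 0 < h → ∀ u v : ℝ,
      F h (u, v) =
        (fh h ⌊u / h⌋ ⌊v / h⌋ * (1 - Int.fract (u / h)) +
           fh h (⌊u / h⌋ + 1) ⌊v / h⌋ * Int.fract (u / h)) * (1 - Int.fract (v / h)) +
        (fh h ⌊u / h⌋ (⌊v / h⌋ + 1) * (1 - Int.fract (u / h)) +
           fh h (⌊u / h⌋ + 1) (⌊v / h⌋ + 1) * Int.fract (u / h)) * Int.fract (v / h)) :
    ∀ p : ℝ × ℝ,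
      Filter.Tendsto (fun h : ℝ => F h p) (nhdsWithin 0 (Set.Ioi 0))
        (nhds (fderiv ℝ Φ p (1, 0))) := by
  rintro ⟨u, v⟩
  set D := fderiv ℝ Φ (u, v) with hD
  have hs : HasStrictFDerivAt Φ D (u, v) :=
    hΦ.contDiffAt.hasStrictFDerivAt one_ne_zero
  rw [Metric.tendsto_nhds]
  intro ε hε
  have hb := hs.isLittleO.def (half_pos hε)
  rw [Metric.eventually_nhds_iff] at hb
  obtain ⟨δ, hδ, hb⟩ := hb
  have hI : Set.Ioo (0 : ℝ) (δ / 2) ∈ nhdsWithin (0 : ℝ) (Set.Ioi 0) :=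
    Ioo_mem_nhdsGT (by positivity)
  filter_upwards [hI] with h hh
  obtain ⟨h0, hhδ⟩ := hh
  have key : ∀ i j : ℤ, |(i : ℝ) * h - u| ≤ h → |(j : ℝ) * h - v| ≤ h →
      |fh h i j - D (1, 0)| ≤ ε / 2 := by
    intro i j hi hj
    rw [abs_le] at hi hj
    have h1 := @hb ((((i : ℝ) + 1) * h, (j : ℝ) * h), (((i : ℝ) - 1) * h, (j : ℝ) * h)) (by
      simp only [Prod.dist_eq, Real.dist_eq, max_lt_iff, abs_lt]
      refine ⟨⟨⟨?_, ?_⟩, ⟨?_, ?_⟩⟩, ⟨⟨?_, ?_⟩, ⟨?_, ?_⟩⟩⟩ <;> nlinarith)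
    have e : ((((i : ℝ) + 1) * h, (j : ℝ) * h) - (((i : ℝ) - 1) * h, (j : ℝ) * h) : ℝ × ℝ)
        = (2 * h) • ((1 : ℝ), (0 : ℝ)) := by
      ext <;> simp
      ring
    have h2 : ‖(2 * h) • ((1 : ℝ), (0 : ℝ))‖ = 2 * h := by
      rw [norm_smul, Prod.norm_def]
      simp [abs_of_pos h0]
    simp only [e, h2, map_smul, smul_eq_mul] at h1
    rw [hfh]
    have e2 : ∀ A d : ℝ, A / (2 * h) - d = (A - 2 * h * d) / (2 * h) := by
      intro A d
      field_simp
    rw [e2, abs_div, abs_of_pos (by positivity : 0 < 2 * h), div_le_iff₀ (by positivity)]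
    exact h1
  have fl : ∀ w : ℝ, |((⌊w / h⌋ : ℤ) : ℝ) * h - w| ≤ h ∧
      |((⌊w / h⌋ + 1 : ℤ) : ℝ) * h - w| ≤ h := by
    intro w
    have a := (le_div_iff₀ h0).1 (Int.floor_le (w / h))
    have b := (div_lt_iff₀ h0).1 (Int.lt_floor_add_one (w / h))
    push_cast
    constructor <;> rw [abs_le] <;> constructor <;> nlinarith
  have conv : ∀ a b L t : ℝ, |a - L| ≤ ε / 2 → |b - L| ≤ ε / 2 → 0 ≤ t → t ≤ 1 →
      |a * (1 - t) + b * t - L| ≤ ε / 2 := by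
    intro a b L t ha hb' h0 h1
    rw [abs_le] at *
    constructor <;> nlinarith
  have x0 := Int.fract_nonneg (u / h)
  have x1 := (Int.fract_lt_one (u / h)).le
  have y0 := Int.fract_nonneg (v / h)
  have y1 := (Int.fract_lt_one (v / h)).le
  rw [hF h h0, Real.dist_eq]
  refine lt_of_le_of_lt ?_ (half_lt_self hε)
  exact conv _ _ _ _
    (conv _ _ _ _ (key _ _ (fl u).1 (fl v).1) (key _ _ (fl u).2 (fl v).1) x0 x1)
    (conv _ _ _ _ (key _ _ (fl u).1 (fl v).2) (key _ _ (fl u).2 (fl v).2) x0 x1) y0 y1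
end
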